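/- arXiv:math/0305313 — 2 statements merged into one kernel-verified Lean document; each statement's English description precedes it below -/
import Mathlib

section
/- (Reversibility of the Ewens measure) For every n ≥ 2, the DCF⁽ⁿ⁾ transition matrix K⁽ⁿ⁾ satisfies the detailed balance equation K⁽ⁿ⁾(ℓ,ℓ')·π_S⁽ⁿ⁾(ℓ) = K⁽ⁿ⁾(ℓ',ℓ)·π_S⁽ⁿ⁾(ℓ') for all ℓ, ℓ' ∈ 𝒫ₙ; in particular π_S⁽ⁿ⁾ is a stationary distribution of the DCF⁽ⁿ⁾ chain. -/
open MeasureTheory ENNReal Filter Set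

noncomputable section

/-- The set `𝒫ₙ` of integer partitions of `n`, as nonincreasing sequences. -/
def PartN (n : ℕ) : Set (ℕ → ℕ) :=
  {l | Antitone l ∧ ∑' i, (l i : ℝ≥0∞) = n}

/-- `N_ℓ(k)`, the number of parts of `ℓ` equal to `k`. -/
def typeCount (l : ℕ → ℕ) (k : ℕ) : ℕ := Nat.card {i | l i = k}

/-- `N_ℓ`, the total number of nonzero parts of `ℓ`. -/
def numParts (l : ℕ → ℕ) : ℕ := Nat.card {i | l i ≠ 0}

/-- `ℓ'` is obtained from `ℓ` by merging a part of size `j` and a part of size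
`k` (`j ≠ k`), expressed through the type counts. -/
def MergeRel (j k : ℕ) (l l' : ℕ → ℕ) : Prop :=
  typeCount l j = typeCount l' j + 1 ∧ typeCount l k = typeCount l' k + 1 ∧
  typeCount l' (j + k) = typeCount l (j + k) + 1 ∧
  ∀ q, q ∉ ({j, k, j + k} : Set ℕ) → typeCount l' q = typeCount l q

/-- `ℓ'` is obtained from `ℓ` by merging two parts of equal size `j`. -/
def EqMergeRel (j : ℕ) (l l' : ℕ → ℕ) : Prop :=
  typeCount l j = typeCount l' j + 2 ∧ typeCount l' (2 * j) = typeCount l (2 * j) + 1 ∧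
  ∀ q, q ∉ ({j, 2 * j} : Set ℕ) → typeCount l' q = typeCount l q

open Classical in
/-- The transition matrix `K⁽ⁿ⁾` of the discrete coagulation-fragmentation chain
DCF⁽ⁿ⁾ (the cycle-type evolution of random transpositions on `Sₙ`): merge and
split rates as in the paper, all other entries being `0`. -/
def Kmat (n : ℕ) (l l' : ℕ → ℕ) : ℝ :=
  (∑ j ∈ Finset.range (n + 1), ∑ k ∈ Finset.range (n + 1),
    ((if 1 ≤ j ∧ j < k ∧ MergeRel j k l l' then
        2 * (j : ℝ) * (k : ℝ) * (typeCount l j : ℝ) * (typeCount l k : ℝ) /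
          ((n : ℝ) * ((n : ℝ) - 1)) else 0)
     + (if 1 ≤ j ∧ j < k ∧ MergeRel j k l' l then
        2 * ((j : ℝ) + (k : ℝ)) * (typeCount l (j + k) : ℝ) /
          ((n : ℝ) * ((n : ℝ) - 1)) else 0)))
  + ∑ j ∈ Finset.range (n + 1),
    ((if 1 ≤ j ∧ 2 * j ≤ n ∧ EqMergeRel j l l' then
        (j : ℝ) ^ 2 * (typeCount l j : ℝ) * ((typeCount l j : ℝ) - 1) /
          ((n : ℝ) * ((n : ℝ) - 1)) else 0)
     + (if 1 ≤ j ∧ 2 * j ≤ n ∧ EqMergeRel j l' l then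
        2 * (j : ℝ) * (typeCount l (2 * j) : ℝ) / ((n : ℝ) * ((n : ℝ) - 1)) else 0))

/-- The Ewens measure `π_S⁽ⁿ⁾(ℓ) = (∏_{k=1}^n k^{N_ℓ(k)} N_ℓ(k)!)⁻¹
  = (∏ᵢ ℓᵢ ∏_{k=1}^n N_ℓ(k)!)⁻¹` on `𝒫ₙ`. -/
def ewens (n : ℕ) (l : ℕ → ℕ) : ℝ :=
  (∏ k ∈ Finset.Icc 1 n,
    ((k : ℝ) ^ typeCount l k * (Nat.factorial (typeCount l k) : ℝ)))⁻¹

lemma PartN.finite_support {n : ℕ} {l : ℕ → ℕ} (h : l ∈ PartN n) : {i | l i ≠ 0}.Finite := by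
  have hne : ∑' i, (l i : ℝ≥0∞) ≠ ⊤ := by rw [h.2]; exact ENNReal.natCast_ne_top n
  refine (ENNReal.finite_const_le_of_tsum_ne_top hne one_ne_zero).subset fun i hi => ?_
  have : 1 ≤ l i := Nat.one_le_iff_ne_zero.2 hi
  simpa using (by exact_mod_cast this : (1 : ℝ≥0∞) ≤ l i)

lemma PartN.le {n : ℕ} {l : ℕ → ℕ} (h : l ∈ PartN n) (i : ℕ) : l i ≤ n := by
  have := ENNReal.le_tsum (f := fun i => (l i : ℝ≥0∞)) i
  rw [h.2] at this
  exact_mod_cast this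

lemma typeCount_eq_zero_of_lt {n : ℕ} {l : ℕ → ℕ} (hl : ∀ i, l i ≤ n) {k : ℕ} (hk : n < k) :
    typeCount l k = 0 := by
  have : {i | l i = k} = ∅ := by
    ext i
    simpa using ((hl i).trans_lt hk).ne
  unfold typeCount
  simp [this]

lemma typeCount_zero {l : ℕ → ℕ} (h : {i | l i ≠ 0}.Finite) : typeCount l 0 = 0 := by
  have h2 : {i | l i = 0}.Infinite := by
    have := h.infinite_compl
    simpa [Set.compl_def] using this
  have : Infinite {i | l i = 0} := h2.to_subtype
  exact Nat.card_eq_zero_of_infinite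

lemma typeCount_eq_card_filter {l : ℕ → ℕ} (h : {i | l i ≠ 0}.Finite) {k : ℕ} (hk : k ≠ 0) :
    typeCount l k = (h.toFinset.filter (fun i => l i = k)).card := by
  have : {i | l i = k} = (h.toFinset.filter (fun i => l i = k) : Finset ℕ) := by
    ext i
    simp
    omega
  unfold typeCount
  rw [this, Nat.card_coe_set_eq, Set.ncard_coe_finset]

/-- The total size `∑ k c_k` of a vector of type counts supported on `{1,…,n}`. -/
def totalSize (n : ℕ) (c : ℕ → ℕ) : ℕ := ∑ k ∈ Finset.Icc 1 n, k * c k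

lemma tsum_eq_totalSize {n : ℕ} {l : ℕ → ℕ} (h : {i | l i ≠ 0}.Finite) (hl : ∀ i, l i ≤ n) :
    ∑' i, (l i : ℝ≥0∞) = (totalSize n (typeCount l) : ℕ) := by
  rw [tsum_eq_sum (s := h.toFinset) (fun i hi => by simpa using hi), ← Nat.cast_sum,
    ← Finset.sum_fiberwise_of_maps_to (t := Finset.Icc 1 n) (g := l)
      (fun i hi => by
        have : l i ≠ 0 := by simpa using hi
        exact Finset.mem_Icc.2 ⟨Nat.one_le_iff_ne_zero.2 this, hl i⟩)]
  congr 1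
  refine Finset.sum_congr rfl fun k hk => ?_
  rw [typeCount_eq_card_filter h (by have := (Finset.mem_Icc.1 hk).1; omega),
    Finset.sum_congr rfl (fun i hi => (Finset.mem_filter.1 hi).2)]
  simp [mul_comm]

/-- For a nonincreasing sequence, the indices of parts exceeding `v` form an initial segment. -/
lemma PartN.lt_iff {n : ℕ} {l : ℕ → ℕ} (h : l ∈ PartN n) (v i : ℕ) :
    v < l i ↔ i < ∑ k ∈ Finset.Ioc v n, typeCount l k := by
  have hfin : {i | v < l i}.Finite :=
    (PartN.finite_support h).subset fun i (hi : v < l i) => (Nat.zero_lt_of_lt hi).ne'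
  have hcard : ∑ k ∈ Finset.Ioc v n, typeCount l k = hfin.toFinset.card := by
    rw [Finset.card_eq_sum_card_fiberwise (f := l) (t := Finset.Ioc v n)]
    · refine Finset.sum_congr rfl fun k hk => ?_
      have hk := Finset.mem_Ioc.1 hk
      rw [typeCount_eq_card_filter (PartN.finite_support h) (by omega)]
      congr 1
      ext i
      simp
      omega
    · intro i hi
      have : v < l i := by simpa using hi
      simpa using ⟨this, PartN.le h i⟩
  rw [hcard]
  constructor
  · intro hi
    have : Finset.range (i + 1) ⊆ hfin.toFinset := fun j hj => by
      have hj : j ≤ i := by simpa [Nat.lt_succ_iff] using hj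
      simpa using hi.trans_le (h.1 hj)
    simpa using Finset.card_le_card this
  · intro hi
    by_contra hv
    have : hfin.toFinset ⊆ Finset.range i := fun j hj => by
      have hj : v < l j := by simpa using hj
      by_contra hji
      have := h.1 (show i ≤ j by simpa using hji)
      omega
    have := Finset.card_le_card this
    simp at this
    omega

lemma typeCount_injOn (n : ℕ) : Set.InjOn typeCount (PartN n) := by
  intro l hl l' hl' h
  ext i
  refine eq_of_forall_lt_iff fun v => ?_
  rw [PartN.lt_iff hl, PartN.lt_iff hl', h]

/-- Every vector of type counts of total size `n` is realised by a partition of `n`. -/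
lemma exists_typeCount_eq {n : ℕ} {c : ℕ → ℕ} (h0 : c 0 = 0) (hc : ∀ k, n < k → c k = 0)
    (hn : totalSize n c = n) : ∃ l ∈ PartN n, typeCount l = c := by
  set T : ℕ → ℕ := fun v => ∑ k ∈ Finset.Ioc v n, c k with hT
  have hTanti : Antitone T := fun a b hab =>
    Finset.sum_le_sum_of_subset (Finset.Ioc_subset_Ioc_left hab)
  have hTn : ∀ v, n ≤ v → T v = 0 := fun v hv => by simp [hT, Finset.Ioc_eq_empty_of_le hv]
  set l : ℕ → ℕ := fun i => ((Finset.range n).filter (fun v => i < T v)).card with hl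
  have hlt : ∀ i v, v < l i ↔ i < T v := by
    intro i v
    constructor
    · intro hv
      by_contra hi
      have : (Finset.range n).filter (fun v => i < T v) ⊆ Finset.range v := fun w hw => by
        have hw := (Finset.mem_filter.1 hw).2
        by_contra hwv
        have := hTanti (show v ≤ w by simpa using hwv)
        omega
      have := Finset.card_le_card this
      simp only [Finset.card_range] at this
      exact absurd hv (not_lt.2 this)
    · intro hi
      have : Finset.range (v + 1) ⊆ (Finset.range n).filter (fun v => i < T v) := fun w hw => by
        have hw : w ≤ v := by simpa [Nat.lt_succ_iff] using hw
        have hwT := hTanti hw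
        refine Finset.mem_filter.2 ⟨?_, by omega⟩
        by_contra hwn
        have := hTn w (by simpa using hwn)
        omega
      simpa using Finset.card_le_card this
  have hle : ∀ i, l i ≤ n := fun i => by
    by_contra h
    have := (hlt i n).1 (by omega)
    rw [hTn n le_rfl] at this
    omega
  have hfin : {i | l i ≠ 0}.Finite := (Set.finite_Iio (T 0)).subset fun i hi =>
    (hlt i 0).1 (Nat.pos_of_ne_zero hi)
  have htc : typeCount l = c := by
    ext k
    rcases Nat.eq_zero_or_pos k with rfl | hk
    · rw [typeCount_zero hfin, h0]
    rcases lt_or_ge n k with hkn | hkn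
    · rw [typeCount_eq_zero_of_lt hle hkn, hc k hkn]
    obtain ⟨m, rfl⟩ : ∃ m, k = m + 1 := ⟨k - 1, by omega⟩
    have hset : {i | l i = m + 1} = Finset.Ico (T (m + 1)) (T m) := by
      ext i
      have h1 := hlt i m
      have h2 := hlt i (m + 1)
      simp only [Set.mem_ofPred_eq, Finset.coe_Ico, Set.mem_Ico]
      omega
    have hTm : T m = c (m + 1) + T (m + 1) := by
      simp only [hT]
      rw [← Finset.insert_Ioc_add_one_left_eq_Ioc (by omega), Finset.sum_insert (by simp)]
    unfold typeCount
    rw [hset]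
    simp [hTm]
  refine ⟨l, ⟨fun i j hij => ?_, ?_⟩, htc⟩
  · by_contra h
    have h1 := (hlt j (l i)).1 (by omega)
    have := (hlt i (l i)).2 (by omega)
    omega
  · rw [tsum_eq_totalSize hfin hle, htc, hn]

lemma PartN.totalSize_typeCount {n : ℕ} {l : ℕ → ℕ} (h : l ∈ PartN n) :
    totalSize n (typeCount l) = n := by
  have := tsum_eq_totalSize (PartN.finite_support h) (PartN.le h)
  rw [h.2] at this
  exact_mod_cast this.symm

lemma PartN.mul_typeCount_le {n : ℕ} {l : ℕ → ℕ} (h : l ∈ PartN n) (k : ℕ) :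
    k * typeCount l k ≤ n := by
  rcases Nat.eq_zero_or_pos k with rfl | hk
  · simp
  rcases lt_or_ge n k with hkn | hkn
  · simp [typeCount_eq_zero_of_lt (PartN.le h) hkn]
  calc k * typeCount l k ≤ totalSize n (typeCount l) :=
        Finset.single_le_sum (f := fun k => k * typeCount l k) (fun _ _ => Nat.zero_le _)
          (Finset.mem_Icc.2 ⟨hk, hkn⟩)
    _ = n := PartN.totalSize_typeCount h

lemma PartN.finite (n : ℕ) : (PartN n).Finite := by
  refine Set.Finite.of_injOn (f := fun l (k : Fin (n + 1)) => typeCount l k)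
    (t := Set.Iic fun _ => n) ?_ ?_ (Set.finite_Iic _)
  · intro l hl k
    rcases Nat.eq_zero_or_pos k.1 with hk | hk
    · simp [hk, typeCount_zero (PartN.finite_support hl)]
    · exact (Nat.le_mul_of_pos_left _ hk).trans ((PartN.mul_typeCount_le hl) k)
  · intro l hl l' hl' h
    refine typeCount_injOn n hl hl' (funext fun k => ?_)
    rcases lt_or_ge n k with hk | hk
    · rw [typeCount_eq_zero_of_lt (PartN.le hl) hk, typeCount_eq_zero_of_lt (PartN.le hl') hk]
    · exact congrFun h ⟨k, by omega⟩

/-- `ℓ'` is obtained from `ℓ` by merging a part of size `j` and a part of size `k`, where `j = k`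
is allowed: both type counts extend a common one. -/
def Coalesces (j k : ℕ) (l l' : ℕ → ℕ) : Prop :=
  ∃ M : ℕ → ℕ, typeCount l = M + Pi.single j 1 + Pi.single k 1 ∧
    typeCount l' = M + Pi.single (j + k) 1

lemma mergeRel_iff_coalesces {j k : ℕ} (hj : 1 ≤ j) (hjk : j < k) (l l' : ℕ → ℕ) :
    MergeRel j k l l' ↔ Coalesces j k l l' := by
  constructor
  · rintro ⟨h1, h2, h3, h4⟩
    refine ⟨fun q => if q = j + k then typeCount l q else typeCount l' q, ?_, ?_⟩ <;>
    · ext q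
      have := h4 q
      simp only [Set.mem_insert_iff, Set.mem_singleton_iff, not_or] at this
      simp only [Pi.add_apply, Pi.single_apply]
      by_cases e1 : q = j
      · subst e1; simp; grind
      by_cases e2 : q = k
      · subst e2; simp; grind
      by_cases e3 : q = j + k
      · subst e3; simp; grind
      simp [e1, e2, e3, this]
  · rintro ⟨M, h1, h2⟩
    simp only [MergeRel, h1, h2, Pi.add_apply, Pi.single_apply, Set.mem_insert_iff,
      Set.mem_singleton_iff, not_or]
    grind

lemma eqMergeRel_iff_coalesces {j : ℕ} (hj : 1 ≤ j) (l l' : ℕ → ℕ) :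
    EqMergeRel j l l' ↔ Coalesces j j l l' := by
  constructor
  · rintro ⟨h1, h2, h3⟩
    refine ⟨fun q => if q = j + j then typeCount l q else typeCount l' q, ?_, ?_⟩ <;>
    · ext q
      have := h3 q
      simp only [Set.mem_insert_iff, Set.mem_singleton_iff, not_or] at this
      simp only [Pi.add_apply, Pi.single_apply]
      grind
  · rintro ⟨M, h1, h2⟩
    simp only [EqMergeRel, h1, h2, Pi.add_apply, Pi.single_apply, Set.mem_insert_iff,
      Set.mem_singleton_iff, not_or]
    grind

/-- The weight `∏ₖ k^{c_k} c_k!` of a vector of type counts, whose inverse is the Ewens measure. -/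
def cycleWeight (n : ℕ) (c : ℕ → ℕ) : ℝ :=
  ∏ k ∈ Finset.Icc 1 n, ((k : ℝ) ^ c k * (Nat.factorial (c k) : ℝ))

lemma ewens_eq_inv_cycleWeight (n : ℕ) (l : ℕ → ℕ) :
    ewens n l = (cycleWeight n (typeCount l))⁻¹ := rfl

lemma cycleWeight_ne_zero (n : ℕ) (c : ℕ → ℕ) : cycleWeight n c ≠ 0 := by
  refine Finset.prod_ne_zero_iff.2 fun k hk => ?_
  have := (Finset.mem_Icc.1 hk).1
  positivity

lemma cycleWeight_add_single {n j : ℕ} (hj : j ∈ Finset.Icc 1 n) (M : ℕ → ℕ) :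
    cycleWeight n (M + Pi.single j 1) = cycleWeight n M * (j * (M j + 1)) := by
  unfold cycleWeight
  rw [← Finset.mul_prod_erase _ _ hj, ← Finset.mul_prod_erase _ _ hj,
    Finset.prod_congr rfl (fun k hk => by
      rw [Pi.add_apply, Pi.single_eq_of_ne (Finset.ne_of_mem_erase hk), add_zero])]
  simp only [Pi.add_apply, Pi.single_eq_same, pow_succ, Nat.factorial_succ]
  push_cast
  ring

lemma totalSize_add_single {n j : ℕ} (hj : j ∈ Finset.Icc 1 n) (M : ℕ → ℕ) :
    totalSize n (M + Pi.single j 1) = totalSize n M + j := by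
  simp [totalSize, mul_add, Finset.sum_add_distrib, Pi.single_apply, Finset.mem_Icc.1 hj]

/-- Detailed balance between one coalescence and its reverse. -/
lemma Coalesces.rate_mul_ewens {n j k : ℕ} {l l' : ℕ → ℕ} (h : Coalesces j k l l') (hj : 1 ≤ j)
    (hk : 1 ≤ k) (hjk : j + k ≤ n) :
    (j : ℝ) * k * typeCount l j * (typeCount l k - if j = k then 1 else 0) * ewens n l =
      (j + k) * typeCount l' (j + k) * ewens n l' := by
  obtain ⟨M, h1, h2⟩ := h
  rw [ewens_eq_inv_cycleWeight, ewens_eq_inv_cycleWeight, ← div_eq_mul_inv, ← div_eq_mul_inv,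
    div_eq_div_iff (cycleWeight_ne_zero _ _) (cycleWeight_ne_zero _ _), h1, h2,
    cycleWeight_add_single (Finset.mem_Icc.2 ⟨hk, by omega⟩),
    cycleWeight_add_single (Finset.mem_Icc.2 ⟨hj, by omega⟩),
    cycleWeight_add_single (Finset.mem_Icc.2 ⟨by omega, hjk⟩)]
  simp only [Pi.add_apply, Pi.single_apply]
  by_cases e : j = k
  · subst e
    push_cast
    simp
    ring
  · push_cast
    simp [e, Ne.symm e]
    ring

lemma PartN.le_of_typeCount_ne_zero {n k : ℕ} {l : ℕ → ℕ} (h : l ∈ PartN n)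
    (hk : typeCount l k ≠ 0) : k ≤ n := by
  by_contra hn
  exact hk (typeCount_eq_zero_of_lt (PartN.le h) (by omega))

lemma Coalesces.add_le {n j k : ℕ} {l l' : ℕ → ℕ} (h : Coalesces j k l l') (hl' : l' ∈ PartN n) :
    j + k ≤ n := by
  obtain ⟨M, -, h2⟩ := h
  exact PartN.le_of_typeCount_ne_zero hl' (by simp [h2])

lemma existsUnique_coalesces {n j k : ℕ} {l : ℕ → ℕ} (hl : l ∈ PartN n) (hj : 1 ≤ j) (hk : 1 ≤ k)
    (hj' : 1 ≤ typeCount l j) (hk' : (if j = k then 2 else 1) ≤ typeCount l k) :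
    ∃! l' : PartN n, Coalesces j k l l' := by
  obtain ⟨M, hM⟩ : ∃ M : ℕ → ℕ, typeCount l = M + Pi.single j 1 + Pi.single k 1 := by
    refine ⟨typeCount l - Pi.single j 1 - Pi.single k 1, ?_⟩
    ext q
    simp only [Pi.add_apply, Pi.sub_apply, Pi.single_apply]
    grind
  have hjn : j ∈ Finset.Icc 1 n :=
    Finset.mem_Icc.2 ⟨hj, PartN.le_of_typeCount_ne_zero hl (by omega)⟩
  have hkn : k ∈ Finset.Icc 1 n :=
    Finset.mem_Icc.2 ⟨hk, PartN.le_of_typeCount_ne_zero hl (by split_ifs at hk' <;> omega)⟩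
  have hsize := PartN.totalSize_typeCount hl
  rw [hM, totalSize_add_single hkn, totalSize_add_single hjn] at hsize
  have hjkn : j + k ∈ Finset.Icc 1 n := Finset.mem_Icc.2 ⟨by omega, by omega⟩
  obtain ⟨l', hl', hc⟩ := exists_typeCount_eq (n := n) (c := M + Pi.single (j + k) 1)
    (by
      have := congrFun hM 0
      rw [typeCount_zero (PartN.finite_support hl)] at this
      simp only [Pi.add_apply, Pi.single_apply] at this ⊢
      grind)
    (fun q hq => by
      have := congrFun hM q
      rw [typeCount_eq_zero_of_lt (PartN.le hl) hq] at this
      simp only [Pi.add_apply, Pi.single_apply] at this ⊢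
      grind)
    (by rw [totalSize_add_single hjkn]; omega)
  refine ⟨⟨l', hl'⟩, ⟨M, hM, hc⟩, ?_⟩
  rintro ⟨l'', hl''⟩ ⟨M', hM', hc'⟩
  refine Subtype.ext (typeCount_injOn n hl'' hl' ?_)
  have : M' = M := add_right_cancel (add_right_cancel (hM'.symm.trans hM))
  rw [hc', hc, this]

lemma existsUnique_coalesces_to {n j k : ℕ} {l : ℕ → ℕ} (hl : l ∈ PartN n) (hj : 1 ≤ j)
    (hk : 1 ≤ k) (hjk : 1 ≤ typeCount l (j + k)) :
    ∃! l' : PartN n, Coalesces j k l' l := by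
  obtain ⟨M, hM⟩ : ∃ M : ℕ → ℕ, typeCount l = M + Pi.single (j + k) 1 := by
    refine ⟨typeCount l - Pi.single (j + k) 1, ?_⟩
    ext q
    simp only [Pi.add_apply, Pi.sub_apply, Pi.single_apply]
    grind
  have hjkn : j + k ≤ n := PartN.le_of_typeCount_ne_zero hl (by omega)
  have hsize := PartN.totalSize_typeCount hl
  rw [hM, totalSize_add_single (Finset.mem_Icc.2 ⟨by omega, hjkn⟩)] at hsize
  obtain ⟨l', hl', hc⟩ := exists_typeCount_eq (n := n) (c := M + Pi.single j 1 + Pi.single k 1)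
    (by
      have := congrFun hM 0
      rw [typeCount_zero (PartN.finite_support hl)] at this
      simp only [Pi.add_apply, Pi.single_apply] at this ⊢
      grind)
    (fun q hq => by
      have := congrFun hM q
      rw [typeCount_eq_zero_of_lt (PartN.le hl) hq] at this
      simp only [Pi.add_apply, Pi.single_apply] at this ⊢
      grind)
    (by
      rw [totalSize_add_single (Finset.mem_Icc.2 ⟨hk, by omega⟩),
        totalSize_add_single (Finset.mem_Icc.2 ⟨hj, by omega⟩)]
      omega)
  refine ⟨⟨l', hl'⟩, ⟨M, hc, hM⟩, ?_⟩
  rintro ⟨l'', hl''⟩ ⟨M', hc', hM'⟩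
  refine Subtype.ext (typeCount_injOn n hl'' hl' ?_)
  have : M' = M := add_right_cancel (hM'.symm.trans hM)
  rw [hc', hc, this]

lemma Kmat_mul_ewens {n : ℕ} {l l' : ℕ → ℕ} (hl : l ∈ PartN n) (hl' : l' ∈ PartN n) :
    Kmat n l l' * ewens n l = Kmat n l' l * ewens n l' := by
  have merge : ∀ {l l' : ℕ → ℕ}, l' ∈ PartN n → ∀ {j k : ℕ}, 1 ≤ j → j < k → MergeRel j k l l' →
      2 * (j : ℝ) * k * typeCount l j * typeCount l k / ((n : ℝ) * (n - 1)) * ewens n l =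
      2 * ((j : ℝ) + k) * typeCount l' (j + k) / ((n : ℝ) * (n - 1)) * ewens n l' := by
    intro l l' hl' j k hj hjk h
    rw [mergeRel_iff_coalesces hj hjk] at h
    have := h.rate_mul_ewens hj (hj.trans hjk.le) (h.add_le hl')
    rw [if_neg hjk.ne] at this
    linear_combination 2 / ((n : ℝ) * (n - 1)) * this
  have eqMerge : ∀ {l l' : ℕ → ℕ} {j : ℕ}, 1 ≤ j → 2 * j ≤ n → EqMergeRel j l l' →
      (j : ℝ) ^ 2 * typeCount l j * (typeCount l j - 1) / ((n : ℝ) * (n - 1)) * ewens n l =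
      2 * (j : ℝ) * typeCount l' (2 * j) / ((n : ℝ) * (n - 1)) * ewens n l' := by
    intro l l' j hj hjn h
    rw [eqMergeRel_iff_coalesces hj] at h
    have := h.rate_mul_ewens (n := n) hj hj (by omega)
    rw [if_pos rfl, ← two_mul, ← two_mul] at this
    linear_combination 1 / ((n : ℝ) * (n - 1)) * this
  unfold Kmat
  simp only [add_mul, Finset.sum_mul]
  congr 1
  · refine Finset.sum_congr rfl fun j _ => Finset.sum_congr rfl fun k _ => ?_
    rw [add_comm]
    congr 1 <;> split_ifs with h
    · exact (merge hl h.1 h.2.1 h.2.2).symm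
    · simp
    · exact merge hl' h.1 h.2.1 h.2.2
    · simp
  · refine Finset.sum_congr rfl fun j _ => ?_
    rw [add_comm]
    congr 1 <;> split_ifs with h
    · exact (eqMerge h.1 h.2.1 h.2.2).symm
    · simp
    · exact eqMerge h.1 h.2.1 h.2.2
    · simp

open Classical in
lemma sum_ite_existsUnique {ι : Type*} [Fintype ι] {p : ι → Prop} {a : ℝ}
    (h : a ≠ 0 → ∃! x, p x) : ∑ x, (if p x then a else 0) = a := by
  by_cases ha : a = 0
  · simp [ha]
  obtain ⟨x, hx, hu⟩ := h ha
  rw [Finset.sum_eq_single x (fun y _ hy => if_neg fun hp => hy (hu y hp)) (by simp), if_pos hx]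

lemma sum_symm_eq {ι : Type*} [LinearOrder ι] (s : Finset ι) (g : ι → ι → ℝ)
    (hg : ∀ j k, g j k = g k j) :
    ∑ j ∈ s, ∑ k ∈ s, g j k =
      (∑ j ∈ s, ∑ k ∈ s, if j < k then 2 * g j k else 0) + ∑ j ∈ s, g j j := by
  have hsplit : ∀ j ∈ s, ∀ k ∈ s, g j k =
      (if j < k then g j k else 0) + (if k < j then g k j else 0) + (if k = j then g j j else 0) := by
    intro j _ k _
    rcases lt_trichotomy j k with h | h | h
    · simp [h, h.not_gt, h.ne']
    · simp [h]
    · simp [h, h.not_gt, h.ne, hg j k]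
  rw [Finset.sum_congr rfl fun j hj => Finset.sum_congr rfl (hsplit j hj)]
  simp only [Finset.sum_add_distrib]
  rw [Finset.sum_comm (f := fun j k => if k < j then g k j else 0), ← Finset.sum_add_distrib]
  congr 1
  · refine Finset.sum_congr rfl fun j _ => ?_
    rw [← Finset.sum_add_distrib]
    refine Finset.sum_congr rfl fun k _ => ?_
    split_ifs <;> ring
  · exact Finset.sum_congr rfl fun j hj => by simp [hj]

lemma sum_sum_add_eq {n : ℕ} {f : ℕ → ℝ} (hf : ∀ m, n < m → f m = 0) :
    ∑ j ∈ Finset.Icc 1 n, ∑ k ∈ Finset.Icc 1 n, f (j + k) =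
      ∑ m ∈ Finset.Icc 1 n, ((m : ℝ) - 1) * f m := by
  have hinner : ∀ j ∈ Finset.Icc 1 n, ∑ k ∈ Finset.Icc 1 n, f (j + k) =
      ∑ m ∈ Finset.Icc 1 n, if j < m then f m else 0 := by
    intro j hj
    rw [← Finset.sum_filter]
    refine Finset.sum_bij_ne_zero (fun k _ _ => j + k) ?_ ?_ ?_ ?_
    · intro k hk hne
      have : j + k ≤ n := by
        by_contra h
        exact hne (hf _ (by omega))
      simp only [Finset.mem_Icc, Finset.mem_filter] at *
      omega
    · intros
      omega
    · intro m hm hne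
      simp only [Finset.mem_Icc, Finset.mem_filter] at *
      exact ⟨m - j, by omega, by rwa [Nat.add_sub_cancel' (by omega)], by omega⟩
    · intros
      rfl
  rw [Finset.sum_congr rfl hinner, Finset.sum_comm]
  refine Finset.sum_congr rfl fun m hm => ?_
  have hm := Finset.mem_Icc.1 hm
  have : (Finset.Icc 1 n).filter (fun j => j < m) = Finset.Ico 1 m := by
    ext j
    simp only [Finset.mem_Icc, Finset.mem_filter, Finset.mem_Ico]
    omega
  rw [← Finset.sum_filter, this, Finset.sum_const, Nat.card_Ico, nsmul_eq_mul, Nat.cast_sub hm.1,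
    Nat.cast_one]

/-- The total rate of merging and splitting parts of a partition of `n` is `n(n-1)`. -/
lemma PartN.sum_rates {n : ℕ} {l : ℕ → ℕ} (hl : l ∈ PartN n) :
    (∑ j ∈ Finset.Icc 1 n, ∑ k ∈ Finset.Icc 1 n, if j < k then
        2 * (j : ℝ) * k * typeCount l j * typeCount l k +
          2 * ((j : ℝ) + k) * typeCount l (j + k) else 0) +
      ∑ j ∈ Finset.Icc 1 n, ((j : ℝ) ^ 2 * typeCount l j * (typeCount l j - 1) +
        2 * (j : ℝ) * typeCount l (2 * j)) = (n : ℝ) * (n - 1) := by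
  have hsize : ∑ k ∈ Finset.Icc 1 n, (k : ℝ) * typeCount l k = n := by
    exact_mod_cast PartN.totalSize_typeCount hl
  have hsym := sum_symm_eq (Finset.Icc 1 n)
    (fun j k => (j : ℝ) * typeCount l j * (k * typeCount l k) +
      ((j + k : ℕ) : ℝ) * typeCount l (j + k)) (fun j k => by rw [add_comm j k]; ring)
  simp only [Finset.sum_add_distrib] at hsym
  rw [← Finset.sum_mul_sum, hsize, sum_sum_add_eq (f := fun m => (m : ℝ) * typeCount l m)
    (fun m hm => by simp [typeCount_eq_zero_of_lt (PartN.le hl) hm])] at hsym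
  simp only [sub_mul, one_mul, Finset.sum_sub_distrib, hsize] at hsym
  have hlt : (∑ j ∈ Finset.Icc 1 n, ∑ k ∈ Finset.Icc 1 n, if j < k then
      2 * (j : ℝ) * k * typeCount l j * typeCount l k +
        2 * ((j : ℝ) + k) * typeCount l (j + k) else 0) =
      ∑ j ∈ Finset.Icc 1 n, ∑ k ∈ Finset.Icc 1 n, if j < k then
        2 * ((j : ℝ) * typeCount l j * (k * typeCount l k) +
          ((j + k : ℕ) : ℝ) * typeCount l (j + k)) else 0 := by
    refine Finset.sum_congr rfl fun j _ => Finset.sum_congr rfl fun k _ => ?_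
    split_ifs
    · push_cast
      ring
    · rfl
  have hdiag : ∑ j ∈ Finset.Icc 1 n, ((j : ℝ) ^ 2 * typeCount l j * (typeCount l j - 1) +
        2 * (j : ℝ) * typeCount l (2 * j)) =
      ∑ j ∈ Finset.Icc 1 n, (j : ℝ) * typeCount l j * (j * typeCount l j) +
        ∑ j ∈ Finset.Icc 1 n, ((j + j : ℕ) : ℝ) * typeCount l (j + j) -
        ∑ j ∈ Finset.Icc 1 n, (j : ℝ) * (j * typeCount l j) := by
    rw [← Finset.sum_add_distrib, ← Finset.sum_sub_distrib]
    refine Finset.sum_congr rfl fun j _ => ?_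
    rw [← two_mul j]
    push_cast
    ring
  rw [hlt, hdiag]
  simp only [mul_assoc] at hsym ⊢
  linarith

lemma sum_range_succ_eq_sum_Icc {n : ℕ} {f : ℕ → ℝ} (hf : f 0 = 0) :
    ∑ j ∈ Finset.range (n + 1), f j = ∑ j ∈ Finset.Icc 1 n, f j := by
  symm
  refine Finset.sum_subset (fun j hj => ?_) fun j hj hj' => ?_
  · simp only [Finset.mem_Icc, Finset.mem_range] at *
    omega
  · obtain rfl : j = 0 := by
      simp only [Finset.mem_Icc, Finset.mem_range] at *
      omega
    exact hf

/-- The rows of `K⁽ⁿ⁾` sum to one. -/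
lemma sum_Kmat {n : ℕ} (hn : 2 ≤ n) {l : ℕ → ℕ} (hl : l ∈ PartN n) [Fintype (PartN n)] :
    ∑ l' : PartN n, Kmat n l l' = 1 := by
  classical
  have hn' : (2 : ℝ) ≤ n := by exact_mod_cast hn
  have hD : (n : ℝ) * (n - 1) ≠ 0 := by
    have : (n : ℝ) - 1 ≠ 0 := by linarith
    positivity
  unfold Kmat
  simp only [Finset.sum_add_distrib (s := (Finset.univ : Finset (PartN n))),
    Finset.sum_comm (s := (Finset.univ : Finset (PartN n))) (t := Finset.range (n + 1))]
  rw [sum_range_succ_eq_sum_Icc (by simp), sum_range_succ_eq_sum_Icc (by simp),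
    Finset.sum_congr rfl fun j _ => sum_range_succ_eq_sum_Icc (by simp)]
  refine Eq.trans ?_ ((div_eq_one_iff_eq hD).2 (PartN.sum_rates hl))
  rw [add_div, Finset.sum_div, Finset.sum_div]
  congr 1
  · refine Finset.sum_congr rfl fun j hj => ?_
    rw [Finset.sum_div]
    refine Finset.sum_congr rfl fun k hk => ?_
    have hj := (Finset.mem_Icc.1 hj).1
    by_cases hjk : j < k
    · simp only [hj, hjk, true_and, if_true, mergeRel_iff_coalesces hj hjk]
      rw [sum_ite_existsUnique, sum_ite_existsUnique, add_div]
      · intro h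
        refine existsUnique_coalesces_to hl hj (by omega) (Nat.one_le_iff_ne_zero.2 fun h0 => h ?_)
        simp [h0]
      · intro h
        refine existsUnique_coalesces hl hj (by omega) (Nat.one_le_iff_ne_zero.2 fun h0 => h ?_) ?_
        · simp [h0]
        · rw [if_neg hjk.ne]
          exact Nat.one_le_iff_ne_zero.2 fun h0 => h (by simp [h0])
    · simp [hjk]
  · refine Finset.sum_congr rfl fun j hj => ?_
    have hj := (Finset.mem_Icc.1 hj).1
    by_cases hjn : 2 * j ≤ n
    · simp only [hj, hjn, true_and, eqMergeRel_iff_coalesces hj]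
      rw [sum_ite_existsUnique, sum_ite_existsUnique, add_div]
      · intro h
        refine existsUnique_coalesces_to hl hj hj (Nat.one_le_iff_ne_zero.2 fun h0 => h ?_)
        rw [← two_mul] at h0
        simp [h0]
      · intro h
        have h0 : typeCount l j ≠ 0 := fun h0 => h (by simp [h0])
        have h1 : typeCount l j ≠ 1 := fun h1 => h (by simp [h1])
        exact existsUnique_coalesces hl hj hj (by omega) (by rw [if_pos rfl]; omega)
    · have h2 : typeCount l (2 * j) = 0 := typeCount_eq_zero_of_lt (PartN.le hl) (by omega)
      have h1 : typeCount l j = 0 ∨ typeCount l j = 1 := by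
        by_contra h
        have := PartN.mul_typeCount_le hl j
        have : j * 2 ≤ j * typeCount l j := Nat.mul_le_mul_left j (by omega)
        omega
      rcases h1 with h1 | h1 <;> simp [hjn, h1, h2]

/-- **Reversibility of the Ewens measure**: for `n ≥ 2` the DCF⁽ⁿ⁾ matrix
`K⁽ⁿ⁾` satisfies detailed balance with respect to `π_S⁽ⁿ⁾`; in particular
`π_S⁽ⁿ⁾` is a stationary distribution of the DCF⁽ⁿ⁾ chain. -/
theorem ewens_detailed_balance (n : ℕ) (hn : 2 ≤ n) :
    (∀ l ∈ PartN n, ∀ l' ∈ PartN n,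
      Kmat n l l' * ewens n l = Kmat n l' l * ewens n l') ∧
    (∀ l' ∈ PartN n, ∑' l : PartN n, ewens n l * Kmat n l l' = ewens n l') := by
  refine ⟨fun l hl l' hl' => Kmat_mul_ewens hl hl', fun l' hl' => ?_⟩
  have := (PartN.finite n).fintype
  rw [tsum_fintype, Finset.sum_congr rfl fun (l : PartN n) _ =>
    (mul_comm _ _).trans (Kmat_mul_ewens l.2 hl'),
    ← Finset.sum_mul, sum_Kmat hn hl', one_mul]

end
end

section
/- (𝒞 is measure determining on Ω₁') If μ and ν are Borel probability measures on Ω₁ with μ(Ω₁') = ν(Ω₁') = 1 and μ(C) = ν(C) for every C ∈ 𝒞, then μ = ν. -/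
open MeasureTheory ENNReal Filter Set

noncomputable section

/-- The space `Ω₁` of ordered partitions of `[0,1]`:
nonincreasing nonnegative sequences of sum `1`. -/
def Omega1 : Set (ℕ → ℝ) :=
  {p | (∀ i, 0 ≤ p i) ∧ Antitone p ∧ ∑' i, p i = 1}

/-- `Ω₁'`: those `p ∈ Ω₁` with `pₙ > Σ_{j>n} pⱼ` for infinitely many `n`. -/
def Omega1' : Set (ℕ → ℝ) :=
  {p | p ∈ Omega1 ∧ {n : ℕ | (∑' j : ℕ, p (n + 1 + j)) < p n}.Infinite}

/-- The index set `I_k` (with `0`-based indices: `a 0, …, a (k-1)` correspond to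
`a₁, …, a_k`, so `a (k-1)` is `a_k`). -/
def ISet (k : ℕ) (a b : ℕ → ℝ) : Prop :=
  (∀ i < k, 0 < a i ∧ a i < b i ∧ b i < 1) ∧
  (∑ i ∈ Finset.range k, b i) < 1 ∧
  1 - (∑ i ∈ Finset.range k, a i) < a (k - 1)

/-- The neighborhood `C_{a,b} = {x ∈ Ω₁ : xᵢ ∈ (aᵢ, bᵢ) for i = 1,…,k}`. -/
def Cab (k : ℕ) (a b : ℕ → ℝ) : Set (ℕ → ℝ) :=
  {x | x ∈ Omega1 ∧ ∀ i < k, x i ∈ Set.Ioo (a i) (b i)}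

open scoped Topology

section OrderedPartitions

variable {p : ℕ → ℝ}

lemma summable_of_mem_Omega1 (hp : p ∈ Omega1) : Summable p := by
  by_contra hs
  have h1 := hp.2.2
  rw [tsum_eq_zero_of_not_summable hs] at h1
  exact zero_ne_one h1

lemma tsum_tail_of_mem_Omega1 (hp : p ∈ Omega1) (n : ℕ) :
    ∑' j : ℕ, p (n + 1 + j) = 1 - ∑ i ∈ Finset.range (n + 1), p i := by
  have h := (summable_of_mem_Omega1 hp).sum_add_tsum_nat_add (n + 1)
  rw [hp.2.2] at h
  simp_rw [add_comm (n + 1)]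
  linarith

lemma pos_of_mem_Omega1' (hp : p ∈ Omega1') (n : ℕ) : 0 < p n := by
  obtain ⟨m, hm, hnm⟩ := hp.2.exists_gt n
  exact ((tsum_nonneg fun j => hp.1.1 _).trans_lt hm).trans_le (hp.1.2.1 hnm.le)

lemma sum_range_lt_one_of_mem_Omega1' (hp : p ∈ Omega1') (n : ℕ) :
    ∑ i ∈ Finset.range n, p i < 1 := by
  have h := (summable_of_mem_Omega1 hp.1).sum_le_tsum (Finset.range (n + 1))
    fun i _ => hp.1.1 i
  rw [hp.1.2.2, Finset.sum_range_succ] at h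
  linarith [pos_of_mem_Omega1' hp n]

lemma lt_one_of_mem_Omega1' (hp : p ∈ Omega1') (n : ℕ) : p n < 1 :=
  (Finset.single_le_sum (fun i _ => hp.1.1 i) (Finset.self_mem_range_succ n)).trans_lt
    (sum_range_lt_one_of_mem_Omega1' hp (n + 1))

lemma measurableSet_Omega1 : MeasurableSet Omega1 := by
  have hset : Omega1 = {p : ℕ → ℝ | ∀ i, 0 ≤ p i} ∩ ({p | ∀ i, p (i + 1) ≤ p i} ∩
      {p | ∑' i, p i = 1}) := by
    ext p
    exact and_congr_right fun _ => and_congr_left fun _ =>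
      ⟨fun h i => h i.le_succ, antitone_nat_of_succ_le⟩
  rw [hset]
  simp only [ofPred_forall]
  refine (MeasurableSet.iInter fun i => measurableSet_le measurable_const
    (measurable_pi_apply i)).inter ((MeasurableSet.iInter fun i => measurableSet_le
      (measurable_pi_apply (i + 1)) (measurable_pi_apply i)).inter ?_)
  exact measurableSet_eq_fun (Measurable.tsum fun i => measurable_pi_apply i) measurable_const

lemma measurableSet_Omega1' : MeasurableSet Omega1' := by
  have hset : Omega1' = Omega1 ∩ ⋂ N : ℕ, ⋃ n : ℕ, ⋃ _ : N < n,
      {p : ℕ → ℝ | 1 - ∑ i ∈ Finset.range (n + 1), p i < p n} := by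
    ext p
    simp only [Omega1', mem_inter_iff, mem_ofPred_eq, mem_iInter, mem_iUnion]
    refine and_congr_right fun hp => ?_
    simp only [tsum_tail_of_mem_Omega1 hp, infinite_iff_exists_gt, mem_ofPred_eq, exists_prop]
    simp only [and_comm]
  rw [hset]
  refine measurableSet_Omega1.inter (MeasurableSet.iInter fun N => MeasurableSet.iUnion fun n =>
    MeasurableSet.iUnion fun _ => measurableSet_lt ?_ (measurable_pi_apply n))
  fun_prop

/-- Every point of `Ω₁'` has arbitrarily small neighborhoods in `𝒞`. -/
lemma exists_ISet_mem_Cab_subset (hp : p ∈ Omega1') {U : Set (ℕ → ℝ)} (hU : IsOpen U)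
    (hpU : p ∈ U) :
    ∃ k a b, 1 ≤ k ∧ ISet k a b ∧ p ∈ Cab k a b ∧ Cab k a b ⊆ U := by
  obtain ⟨I, u, hu, hIU⟩ := isOpen_pi_iff.1 hU p hpU
  obtain ⟨m, hm⟩ := I.bddAbove
  obtain ⟨n, hn, hmn⟩ := hp.2.exists_gt m
  rw [mem_ofPred_eq, tsum_tail_of_mem_Omega1 hp.1] at hn
  have hev {f g : ℝ → ℝ} (hf : Continuous f) (hg : Continuous g) (hfg : f 0 < g 0) :
      ∀ᶠ ε in 𝓝[>] 0, f ε < g ε :=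
    (hf.continuousAt.eventually_lt hg.continuousAt hfg).filter_mono nhdsWithin_le_nhds
  have hbox : ∀ᶠ ε in 𝓝[>] (0 : ℝ), ∀ i ∈ I, Ioo (p i - ε) (p i + ε) ⊆ u i := by
    rw [Filter.eventually_all_finset]
    intro i hi
    obtain ⟨r, hr, hru⟩ := Metric.isOpen_iff.1 (hu i hi).1 _ (hu i hi).2
    filter_upwards [hev continuous_id continuous_const hr] with ε hε
    rw [← Real.ball_eq_Ioo]
    exact (Metric.ball_subset_ball (le_of_lt hε)).trans hru
  have hlow : ∀ᶠ ε in 𝓝[>] (0 : ℝ), ∀ i ∈ Finset.range (n + 1), 0 < p i - ε := by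
    rw [Filter.eventually_all_finset]
    exact fun i _ => hev (by fun_prop) (by fun_prop) (by simpa using pos_of_mem_Omega1' hp i)
  have hupp : ∀ᶠ ε in 𝓝[>] (0 : ℝ), ∀ i ∈ Finset.range (n + 1), p i + ε < 1 := by
    rw [Filter.eventually_all_finset]
    exact fun i _ => hev (by fun_prop) (by fun_prop) (by simpa using lt_one_of_mem_Omega1' hp i)
  have hsum : ∀ᶠ ε in 𝓝[>] (0 : ℝ), ∑ i ∈ Finset.range (n + 1), (p i + ε) < 1 :=
    hev (by fun_prop) (by fun_prop)
      (by simpa only [add_zero] using sum_range_lt_one_of_mem_Omega1' hp (n + 1))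
  have htail : ∀ᶠ ε in 𝓝[>] (0 : ℝ), 1 - ∑ i ∈ Finset.range (n + 1), (p i - ε) < p n - ε :=
    hev (by fun_prop) (by fun_prop) (by simpa only [sub_zero] using hn)
  obtain ⟨ε, hbox, hlow, hupp, hsum, htail, (hε : 0 < ε)⟩ :=
    (hbox.and (hlow.and (hupp.and (hsum.and (htail.and self_mem_nhdsWithin))))).exists
  refine ⟨n + 1, fun i => p i - ε, fun i => p i + ε, by omega, ⟨fun i hi => ⟨?_, ?_, ?_⟩, hsum, ?_⟩,
    ⟨hp.1, fun i _ => ⟨by linarith, by linarith⟩⟩, fun q hq => hIU fun i hi => ?_⟩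
  · exact hlow i (Finset.mem_range.2 hi)
  · linarith
  · exact hupp i (Finset.mem_range.2 hi)
  · simpa only [Nat.add_sub_cancel] using htail
  · exact hbox i hi (hq.2 i (by have := hm hi; omega))

lemma exists_isOpen_Cab_eq (k : ℕ) (a b : ℕ → ℝ) :
    ∃ U : Set (ℕ → ℝ), IsOpen U ∧ Cab k a b = Omega1 ∩ U := by
  refine ⟨(Iio k).pi fun i => Ioo (a i) (b i),
    isOpen_set_pi (finite_Iio k) fun _ _ => isOpen_Ioo, ?_⟩
  ext x
  simp [Cab, Set.mem_pi]

/-- Nonempty intersections of members of `𝒞` are again members of `𝒞`. -/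
lemma exists_ISet_Cab_inter {k l : ℕ} {a b c d : ℕ → ℝ} (hkl : k ≤ l)
    (hcd : ISet l c d) (hne : (Cab k a b ∩ Cab l c d).Nonempty) :
    ∃ e f, ISet l e f ∧ Cab l e f = Cab k a b ∩ Cab l c d := by
  obtain ⟨x, hx, hx'⟩ := hne
  have hce (i : ℕ) : c i ≤ if i < k then max (a i) (c i) else c i := by split_ifs <;> simp
  have hfd (i : ℕ) : (if i < k then min (b i) (d i) else d i) ≤ d i := by split_ifs <;> simp
  refine ⟨fun i => if i < k then max (a i) (c i) else c i,
    fun i => if i < k then min (b i) (d i) else d i, ⟨fun i hi => ⟨?_, ?_, ?_⟩, ?_, ?_⟩, ?_⟩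
  · exact (hcd.1 i hi).1.trans_le (hce i)
  · have h' := hx'.2 i hi
    dsimp only
    split_ifs with hik
    · have h := hx.2 i hik
      exact (max_lt h.1 h'.1).trans (lt_min h.2 h'.2)
    · exact h'.1.trans h'.2
  · exact (hfd i).trans_lt (hcd.1 i hi).2.2
  · exact (Finset.sum_le_sum fun i _ => hfd i).trans_lt hcd.2.1
  · have h := Finset.sum_le_sum (s := Finset.range l) fun i _ => hce i
    linarith [hcd.2.2, hce (l - 1)]
  · ext y
    simp only [Cab, mem_inter_iff, mem_ofPred_eq, mem_Ioo]
    constructor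
    · rintro ⟨hy, h⟩
      refine ⟨⟨hy, fun i hi => ?_⟩, hy, fun i hi =>
        ⟨(hce i).trans_lt (h i hi).1, (h i hi).2.trans_le (hfd i)⟩⟩
      have := h i (hi.trans_le hkl)
      simp only [hi, if_true, max_lt_iff, lt_min_iff] at this
      exact ⟨this.1.1, this.2.1⟩
    · rintro ⟨⟨hy, h⟩, -, hl⟩
      refine ⟨hy, fun i hi => ?_⟩
      split_ifs with hik
      · exact ⟨max_lt (h i hik).1 (hl i hi).1, lt_min (h i hik).2 (hl i hi).2⟩
      · exact hl i hi

/-- The traces on `Ω₁'` of the members of `𝒞`. -/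
def calCTrace : Set (Set Omega1') :=
  {s | ∃ k a b, 1 ≤ k ∧ ISet k a b ∧ s = Subtype.val ⁻¹' Cab k a b}

lemma isPiSystem_calCTrace : IsPiSystem calCTrace := by
  rintro _ ⟨k, a, b, hk, hab, rfl⟩ _ ⟨l, c, d, hl, hcd, rfl⟩ ⟨x, hx, hx'⟩
  rw [← preimage_inter]
  rcases le_total k l with hkl | hlk
  · obtain ⟨e, f, hef, h⟩ := exists_ISet_Cab_inter hkl hcd ⟨x, hx, hx'⟩
    exact ⟨l, e, f, hl, hef, by rw [h]⟩
  · obtain ⟨e, f, hef, h⟩ := exists_ISet_Cab_inter hlk hab ⟨x, hx', hx⟩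
    exact ⟨k, e, f, hk, hef, by rw [h, inter_comm]⟩

lemma isTopologicalBasis_calCTrace : TopologicalSpace.IsTopologicalBasis calCTrace := by
  refine TopologicalSpace.isTopologicalBasis_of_isOpen_of_nhds ?_ ?_
  · rintro _ ⟨k, a, b, -, -, rfl⟩
    obtain ⟨U, hU, h⟩ := exists_isOpen_Cab_eq k a b
    have hΩ : (Subtype.val ⁻¹' Omega1 : Set Omega1') = univ := eq_univ_of_forall fun x => x.2.1
    rw [h, preimage_inter, hΩ, univ_inter]
    exact hU.preimage continuous_subtype_val
  · rintro x V hxV hV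
    obtain ⟨U, hU, rfl⟩ := isOpen_induced_iff.1 hV
    obtain ⟨k, a, b, hk, hab, hx, hsub⟩ := exists_ISet_mem_Cab_subset x.2 hU hxV
    exact ⟨_, ⟨k, a, b, hk, hab, rfl⟩, hx, preimage_mono hsub⟩

end OrderedPartitions

/-- **Claim (5.2)** (`𝒞` is measure determining on `Ω₁'`): two Borel probability
measures on `Ω₁` giving full mass to `Ω₁'` and agreeing on every `C ∈ 𝒞`
coincide. -/
theorem calC_measure_determining (μ ν : Measure (ℕ → ℝ))
    (hμprob : IsProbabilityMeasure μ) (hνprob : IsProbabilityMeasure ν)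
    (hμ : μ Omega1' = 1) (hν : ν Omega1' = 1)
    (h : ∀ k : ℕ, 1 ≤ k → ∀ a b : ℕ → ℝ, ISet k a b →
      μ (Cab k a b) = ν (Cab k a b)) :
    μ = ν := by
  have hemb := MeasurableEmbedding.subtype_coe measurableSet_Omega1'
  have hfull (ρ : Measure (ℕ → ℝ)) [IsProbabilityMeasure ρ] (hρ : ρ Omega1' = 1) :
      ρ.restrict Omega1' = ρ :=
    Measure.restrict_eq_self_of_ae_mem ((mem_ae_iff_prob_eq_one measurableSet_Omega1').2 hρ)
  have hmap (ρ : Measure (ℕ → ℝ)) [IsProbabilityMeasure ρ] (hρ : ρ Omega1' = 1) :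
      (ρ.comap (Subtype.val : Omega1' → ℕ → ℝ)).map Subtype.val = ρ := by
    rw [hemb.map_comap, Subtype.range_coe, hfull ρ hρ]
  have hpre (ρ : Measure (ℕ → ℝ)) [IsProbabilityMeasure ρ] (hρ : ρ Omega1' = 1)
      (s : Set (ℕ → ℝ)) : ρ.comap (Subtype.val : Omega1' → ℕ → ℝ) (Subtype.val ⁻¹' s) = ρ s := by
    rw [← hemb.map_apply, hmap ρ hρ]
  have hfin : IsFiniteMeasure (μ.comap (Subtype.val : Omega1' → ℕ → ℝ)) :=
    ⟨by rw [← preimage_univ (f := Subtype.val), hpre μ hμ]; exact measure_lt_top _ _⟩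
  have hcomap : μ.comap (Subtype.val : Omega1' → ℕ → ℝ) = ν.comap Subtype.val := by
    refine ext_of_generate_finite calCTrace ?_ isPiSystem_calCTrace ?_ ?_
    · rw [← isTopologicalBasis_calCTrace.borel_eq_generateFrom]
      exact BorelSpace.measurable_eq
    · rintro _ ⟨k, a, b, hk, hab, rfl⟩
      rw [hpre μ hμ, hpre ν hν, h k hk a b hab]
    · rw [← preimage_univ (f := Subtype.val), hpre μ hμ, hpre ν hν, measure_univ, measure_univ]
  rw [← hmap μ hμ, hcomap, hmap ν hν]
end
end
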